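/- arXiv:2408.04759 — 2 statements merged into one kernel-verified Lean document; each statement's English description precedes it below -/
import Mathlib

section
/- Let L_1, ..., L_n be i.i.d. random variables taking values in [0,1] with common mean R = E[L_1], let alpha in (0,1), and define the empirical risk R_hat = (1/n) * sum_{i=1}^n L_i. Define h_1(a,b) = a*log(a/b) + (1-a)*log((1-a)/(1-b)) and the Hoeffding-Bentkus p-value p^{H-B} = min{ e * P(Bin(n, alpha) <= ceil(n * R_hat)), exp(-n * h_1(min{R_hat, alpha}, alpha)) }, where Bin(n, alpha) denotes a Binomial random variable with n trials and success probability alpha and e is Euler's number. If the null hypothesis holds, i.e. R > alpha, then p^{H-B} is super-uniform: for all u in (0,1), P(p^{H-B} <= u) <= u. -/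
open MeasureTheory ProbabilityTheory Real

/-- The CDF of a Binomial distribution with `n` trials and success probability `α`,
evaluated at a real point `x`: `P(Bin(n, α) ≤ x)`. -/
noncomputable def binomCdf (n : ℕ) (α : ℝ) (x : ℝ) : ℝ :=
  ∑ i ∈ Finset.range (n + 1),
    if (i : ℝ) ≤ x then (n.choose i : ℝ) * α ^ i * (1 - α) ^ (n - i) else 0

/-- The binary Kullback-Leibler divergence
`h₁(a, b) = a·log(a/b) + (1-a)·log((1-a)/(1-b))`. -/
noncomputable def h1 (a b : ℝ) : ℝ :=
  a * Real.log (a / b) + (1 - a) * Real.log ((1 - a) / (1 - b))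

/-- The Hoeffding-Bentkus p-value computed from the empirical risk `R̂`:
`p^{H-B} = min { e · P(Bin(n,α) ≤ ⌈n·R̂⌉), exp(-n · h₁(min{R̂, α}, α)) }`. -/
noncomputable def pHB (n : ℕ) (α : ℝ) (Rhat : ℝ) : ℝ :=
  min (Real.exp 1 * binomCdf n α (⌈(n : ℝ) * Rhat⌉₊ : ℝ))
    (Real.exp (-(n : ℝ) * h1 (min Rhat α) α))

/-- The binomial weight `P(Bin(n, α) = i)`. -/
noncomputable def binomWeight (n : ℕ) (α : ℝ) (i : ℕ) : ℝ :=
  (n.choose i : ℝ) * α ^ i * (1 - α) ^ (n - i)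

lemma binomWeight_nonneg {n : ℕ} {α : ℝ} (hα : α ∈ Set.Icc (0 : ℝ) 1) (i : ℕ) :
    0 ≤ binomWeight n α i := by
  have := hα.1
  have : 0 ≤ 1 - α := sub_nonneg.2 hα.2
  unfold binomWeight
  positivity

lemma binomWeight_pos {n : ℕ} {α : ℝ} (hα : α ∈ Set.Ioo (0 : ℝ) 1) {i : ℕ} (hi : i ≤ n) :
    0 < binomWeight n α i := by
  have := hα.1
  have : 0 < 1 - α := sub_pos.2 hα.2
  have := Nat.choose_pos hi
  unfold binomWeight
  positivity

lemma binomWeight_eq_zero {n : ℕ} {α : ℝ} {i : ℕ} (hi : n < i) : binomWeight n α i = 0 := by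
  simp [binomWeight, Nat.choose_eq_zero_of_lt hi]

lemma sum_binomWeight (n : ℕ) (α : ℝ) : ∑ i ∈ Finset.range (n + 1), binomWeight n α i = 1 := by
  have h := add_pow α (1 - α) n
  rw [add_sub_cancel, one_pow] at h
  rw [h]
  exact Finset.sum_congr rfl fun i _ => by unfold binomWeight; ring

/-- Conditioning on the last trial of a binomial variable. -/
lemma sum_binomWeight_succ_mul (n : ℕ) (α : ℝ) (f : ℕ → ℝ) :
    ∑ i ∈ Finset.range (n + 1 + 1), binomWeight (n + 1) α i * f i =
      (1 - α) * ∑ i ∈ Finset.range (n + 1), binomWeight n α i * f i +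
        α * ∑ i ∈ Finset.range (n + 1), binomWeight n α i * f (i + 1) := by
  have h := Finset.sum_antidiagonal_choose_succ_mul
    (fun i j => α ^ i * (1 - α) ^ j * f i) n
  have h2 : ∀ ij ∈ Finset.HasAntidiagonal.antidiagonal n, ((n.choose ij.2 : ℕ) : ℝ) *
      (α ^ (ij.1 + 1) * (1 - α) ^ ij.2 * f (ij.1 + 1)) =
      (n.choose ij.1 : ℝ) * (α ^ (ij.1 + 1) * (1 - α) ^ ij.2 * f (ij.1 + 1)) := by
    intro ij hij
    rw [Nat.choose_symm_of_eq_add (Finset.HasAntidiagonal.mem_antidiagonal.1 hij).symm]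
  rw [Finset.sum_congr rfl h2,
    Finset.Nat.sum_antidiagonal_eq_sum_range_succ
      (fun i j => ((n + 1).choose i : ℝ) * (α ^ i * (1 - α) ^ j * f i)),
    Finset.Nat.sum_antidiagonal_eq_sum_range_succ
      (fun i j => (n.choose i : ℝ) * (α ^ i * (1 - α) ^ (j + 1) * f i)),
    Finset.Nat.sum_antidiagonal_eq_sum_range_succ
      (fun i j => (n.choose i : ℝ) * (α ^ (i + 1) * (1 - α) ^ j * f (i + 1)))] at h
  rw [Finset.mul_sum, Finset.mul_sum]
  convert h using 1
  · exact Finset.sum_congr rfl fun i _ => by unfold binomWeight; ring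
  · congr 1 <;> exact Finset.sum_congr rfl fun i _ => by unfold binomWeight; ring

/-- Ratios of consecutive binomial weights decrease. -/
lemma binomWeight_mul_le {n : ℕ} {α : ℝ} (hα : α ∈ Set.Icc (0 : ℝ) 1) {i j : ℕ} (hij : i ≤ j) :
    binomWeight n α (j + 1) * binomWeight n α i ≤
      binomWeight n α j * binomWeight n α (i + 1) := by
  rcases Nat.lt_or_ge n (j + 1) with hj | hj
  · rw [binomWeight_eq_zero hj, zero_mul]
    exact mul_nonneg (binomWeight_nonneg hα _) (binomWeight_nonneg hα _)
  have hchoose : n.choose (j + 1) * n.choose i ≤ n.choose j * n.choose (i + 1) := by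
    have h1 := Nat.choose_succ_right_eq n j
    have h2 := Nat.choose_succ_right_eq n i
    have hpos : 0 < (j + 1) * (n - i) := Nat.mul_pos (by omega) (by omega)
    refine Nat.le_of_mul_le_mul_right ?_ hpos
    calc n.choose (j + 1) * n.choose i * ((j + 1) * (n - i))
        = (n.choose (j + 1) * (j + 1)) * (n.choose i * (n - i)) := by ring
      _ = n.choose j * n.choose (i + 1) * ((i + 1) * (n - j)) := by rw [h1, ← h2]; ring
      _ ≤ n.choose j * n.choose (i + 1) * ((j + 1) * (n - i)) := by gcongr
  have hchoose' : (n.choose (j + 1) : ℝ) * n.choose i ≤ n.choose j * n.choose (i + 1) := by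
    exact_mod_cast hchoose
  have h0 := hα.1
  have h1 : 0 ≤ 1 - α := sub_nonneg.2 hα.2
  obtain ⟨d, rfl⟩ := Nat.exists_eq_add_of_le hj
  obtain ⟨e, rfl⟩ := Nat.exists_eq_add_of_le hij
  unfold binomWeight
  rw [show i + e + 1 + d - (i + e + 1) = d by omega, show i + e + 1 + d - i = e + 1 + d by omega,
    show i + e + 1 + d - (i + e) = d + 1 by omega, show i + e + 1 + d - (i + 1) = e + d by omega]
  have := mul_le_mul_of_nonneg_right hchoose'
    (show 0 ≤ α ^ (i + e + 1 + i) * (1 - α) ^ (e + 1 + d + d) by positivity)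
  calc _ = _ := by ring
    _ ≤ _ := this
    _ = _ := by ring

/-- The binomial distribution function at the integer `k`, as a partial sum of the weights. -/
lemma binomCdf_natCast (n : ℕ) (α : ℝ) (k : ℕ) :
    binomCdf n α k = ∑ i ∈ Finset.range (k + 1), binomWeight n α i := by
  unfold binomCdf
  rw [← Finset.sum_filter]
  change ∑ i ∈ _, binomWeight n α i = _
  refine Finset.sum_subset ?_ ?_
  · intro i hi
    simp only [Finset.mem_filter, Finset.mem_range, Nat.cast_le] at hi ⊢
    omega
  · intro i hi hi'
    simp only [Finset.mem_filter, Finset.mem_range, Nat.cast_le] at hi hi'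
    exact binomWeight_eq_zero (by omega)

lemma binomCdf_natCast_succ (n : ℕ) (α : ℝ) (k : ℕ) :
    binomCdf n α ((k + 1 : ℕ) : ℝ) = binomCdf n α k + binomWeight n α (k + 1) := by
  rw [binomCdf_natCast, binomCdf_natCast, Finset.sum_range_succ]

lemma binomCdf_natCast_pos {n : ℕ} {α : ℝ} (hα : α ∈ Set.Ioo (0 : ℝ) 1) (k : ℕ) :
    0 < binomCdf n α k := by
  rw [binomCdf_natCast]
  exact Finset.sum_pos' (fun i _ => binomWeight_nonneg (Set.Ioo_subset_Icc_self hα) i)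
    ⟨0, by simp, binomWeight_pos hα (Nat.zero_le n)⟩

lemma binomCdf_eq_one {n : ℕ} {α : ℝ} {k : ℕ} (hk : n ≤ k) : binomCdf n α k = 1 := by
  unfold binomCdf
  refine Eq.trans ?_ (sum_binomWeight n α)
  refine Finset.sum_congr rfl fun i hi => if_pos ?_
  exact_mod_cast (Nat.lt_succ_iff.1 (Finset.mem_range.1 hi)).trans hk

/-- Log-concavity of the binomial distribution function, in increment form. -/
lemma binomCdf_mul_binomWeight_le {n : ℕ} {α : ℝ} (hα : α ∈ Set.Icc (0 : ℝ) 1) (j : ℕ) :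
    binomCdf n α j * binomWeight n α (j + 2) ≤
      binomCdf n α ((j + 1 : ℕ) : ℝ) * binomWeight n α (j + 1) := by
  rw [binomCdf_natCast, binomCdf_natCast, Finset.sum_range_succ' _ (j + 1), add_mul,
    Finset.sum_mul, Finset.sum_mul]
  refine (Finset.sum_le_sum fun i hi => ?_).trans
    (le_add_of_nonneg_right (mul_nonneg (binomWeight_nonneg hα _) (binomWeight_nonneg hα _)))
  have := binomWeight_mul_le (n := n) hα (show i ≤ j + 1 by have := Finset.mem_range.1 hi; omega)
  linarith

lemma sum_binomCdf_mul_le {n : ℕ} {α : ℝ} (hα : α ∈ Set.Ioo (0 : ℝ) 1) (k : ℕ) :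
    (∑ j ∈ Finset.range (k + 1), binomCdf n α j) * binomWeight n α (k + 1) ≤
      binomCdf n α k * binomCdf n α ((k + 1 : ℕ) : ℝ) := by
  have hα' := Set.Ioo_subset_Icc_self hα
  induction k with
  | zero =>
    rw [zero_add, Finset.sum_range_one, ← zero_add 1, binomCdf_natCast_succ]
    have := binomCdf_natCast_pos (n := n) hα 0
    nlinarith
  | succ k ih =>
    have hw := binomWeight_nonneg (n := n) hα' (k + 1 + 1)
    rcases Nat.lt_or_ge n (k + 1) with hn | hn
    · rw [binomWeight_eq_zero (show n < k + 1 + 1 by omega), mul_zero]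
      exact (mul_pos (binomCdf_natCast_pos hα _) (binomCdf_natCast_pos hα _)).le
    have hpos := binomWeight_pos hα hn
    have hG := binomCdf_natCast_pos (n := n) hα (k + 1)
    have hlc := binomCdf_mul_binomWeight_le (n := n) hα' k
    have hsum : (∑ j ∈ Finset.range (k + 1), binomCdf n α j) * binomWeight n α (k + 1 + 1) ≤
        binomCdf n α ((k + 1 : ℕ) : ℝ) * binomCdf n α ((k + 1 : ℕ) : ℝ) := by
      refine le_of_mul_le_mul_right ?_ hpos
      have h1 := mul_le_mul_of_nonneg_right ih hw
      have h2 := mul_le_mul_of_nonneg_left hlc hG.le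
      linarith
    rw [Finset.sum_range_succ, add_mul, binomCdf_natCast_succ n α (k + 1), mul_add]
    linarith

/-- Beyond `k`, the binomial distribution function grows at most geometrically. -/
lemma binomCdf_add_le {n : ℕ} {α : ℝ} (hα : α ∈ Set.Ioo (0 : ℝ) 1) {k : ℕ} {δ : ℝ}
    (hδ : binomWeight n α (k + 1) = δ * binomCdf n α k) (i : ℕ) :
    binomCdf n α ((k + i : ℕ) : ℝ) ≤ binomCdf n α k * (1 + δ) ^ i := by
  have hα' := Set.Ioo_subset_Icc_self hα
  have hδ0 : 0 ≤ δ := by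
    have := binomWeight_nonneg (n := n) hα' (k + 1)
    exact nonneg_of_mul_nonneg_left (hδ ▸ this) (binomCdf_natCast_pos hα k)
  have hinc : ∀ i : ℕ, binomWeight n α (k + i + 1) ≤ δ * binomCdf n α ((k + i : ℕ) : ℝ) := by
    intro i
    induction i with
    | zero => simpa using hδ.le
    | succ i ih =>
      refine le_of_mul_le_mul_left ?_ (binomCdf_natCast_pos (n := n) hα (k + i))
      have h1 := binomCdf_mul_binomWeight_le (n := n) hα' (k + i)
      have h2 := mul_le_mul_of_nonneg_left ih (binomCdf_natCast_pos (n := n) hα (k + i + 1)).le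
      rw [← add_assoc]
      linarith
  induction i with
  | zero => simp
  | succ i ih =>
    rw [← add_assoc, binomCdf_natCast_succ, pow_succ]
    have := mul_le_mul_of_nonneg_right ih (show 0 ≤ 1 + δ by linarith)
    linarith [hinc i]

/-- Every `δ > 0` admits a positive integer `m` with `(1 + δ) ^ m ≤ e · m · δ`. -/
lemma exists_one_add_pow_le {δ : ℝ} (hδ : 0 < δ) :
    ∃ m : ℕ, 0 < m ∧ (1 + δ) ^ m ≤ Real.exp 1 * (m * δ) := by
  have hm0 : 0 < ⌈1 / δ⌉₊ := Nat.ceil_pos.2 (by positivity)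
  have hle := Nat.le_ceil (1 / δ)
  have hlt := Nat.ceil_lt_add_one (show 0 ≤ 1 / δ by positivity)
  generalize ⌈1 / δ⌉₊ = m at *
  refine ⟨m, hm0, ?_⟩
  have hm : (0 : ℝ) < m := by exact_mod_cast hm0
  have hx1 : 1 ≤ m * δ := by rwa [div_le_iff₀ hδ] at hle
  have hx2 : m * δ ≤ 1 + δ := by
    have := mul_lt_mul_of_pos_right hlt hδ
    rw [add_mul, div_mul_cancel₀ _ hδ.ne'] at this
    linarith
  set x : ℝ := m * δ with hx
  have hexp : (1 + 1 / (m : ℝ)) ^ m ≤ Real.exp 1 := by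
    calc (1 + 1 / (m : ℝ)) ^ m ≤ (Real.exp (1 / m)) ^ m := by
          gcongr
          linarith [Real.add_one_le_exp (1 / (m : ℝ))]
      _ = Real.exp 1 := by rw [← Real.exp_nat_mul]; field_simp
  have hbern : ((m + x) / (m + 1)) ^ m ≤ x := by
    have h1 := one_add_mul_le_pow (a := (m + 1) / (m + x) - 1)
      (by have : (0 : ℝ) ≤ (m + 1) / (m + x) := by positivity
          linarith) m
    rw [add_sub_cancel] at h1
    have h2 : 1 / x ≤ 1 + m * ((m + 1) / (m + x) - 1) := by
      have hmx : x * m ≤ m + x := by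
        have : m * x ≤ m * (1 + δ) := by gcongr
        linarith
      have hxpos : 0 < x := by linarith
      have hid : 1 + m * ((m + 1) / (m + x) - 1) - 1 / x =
          (x - 1) * (m + x - x * m) / (x * (m + x)) := by
        field_simp
        ring
      have : 0 ≤ (x - 1) * (m + x - x * m) / (x * (m + x)) :=
        div_nonneg (mul_nonneg (by linarith) (by linarith)) (by positivity)
      linarith
    have h3 := h2.trans h1
    rw [← inv_div, inv_pow, ← one_div]
    exact (one_div_le (by linarith) (by positivity)).1 h3
  calc (1 + δ) ^ m = (1 + 1 / (m : ℝ)) ^ m * ((m + x) / (m + 1)) ^ m := by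
        rw [← mul_pow, hx]
        congr 1
        field_simp
    _ ≤ Real.exp 1 * x := by gcongr

/-- The truncated first moment bound behind the constant `e`. -/
lemma exists_sum_binomCdf_le {n : ℕ} {α : ℝ} (hα : α ∈ Set.Ioo (0 : ℝ) 1) {k : ℕ} (hk : k < n) :
    ∃ m : ℕ, 0 < m ∧
      ∑ j ∈ Finset.range (k + m), binomCdf n α j ≤ Real.exp 1 * (m * binomCdf n α k) := by
  have hG := binomCdf_natCast_pos (n := n) hα k
  obtain ⟨δ, hδ⟩ : ∃ δ, binomWeight n α (k + 1) = δ * binomCdf n α k :=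
    ⟨_, (div_mul_cancel₀ _ hG.ne').symm⟩
  have hδ0 : 0 < δ := pos_of_mul_pos_left (hδ ▸ binomWeight_pos hα hk) hG.le
  have hfirst : (∑ j ∈ Finset.range (k + 1), binomCdf n α j) * δ ≤
      binomCdf n α k * (1 + δ) := by
    have h := sum_binomCdf_mul_le (n := n) hα k
    rw [binomCdf_natCast_succ, hδ] at h
    refine le_of_mul_le_mul_right ?_ hG
    linarith
  have hall : ∀ m : ℕ, (∑ j ∈ Finset.range (k + (m + 1)), binomCdf n α j) * δ ≤
      binomCdf n α k * (1 + δ) ^ (m + 1) := by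
    intro m
    induction m with
    | zero => simpa using hfirst
    | succ m ih =>
      rw [← add_assoc k, Finset.sum_range_succ, add_mul, pow_succ]
      have := mul_le_mul_of_nonneg_right (binomCdf_add_le hα hδ (m + 1)) hδ0.le
      linarith
  obtain ⟨m, hm, hle⟩ := exists_one_add_pow_le hδ0
  refine ⟨m, hm, le_of_mul_le_mul_right ?_ hδ0⟩
  obtain ⟨m, rfl⟩ := Nat.exists_eq_succ_of_ne_zero hm.ne'
  calc _ ≤ _ := hall m
    _ ≤ binomCdf n α k * (Real.exp 1 * ((m + 1 : ℕ) * δ)) := by gcongr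
    _ = _ := by ring

lemma sum_binomWeight_mul_max (n : ℕ) (α : ℝ) (h : ℕ) :
    ∑ i ∈ Finset.range (n + 1), binomWeight n α i * max ((h : ℝ) - i) 0 =
      ∑ j ∈ Finset.range h, binomCdf n α j := by
  unfold binomCdf
  rw [Finset.sum_comm]
  refine Finset.sum_congr rfl fun i _ => ?_
  change _ = ∑ j ∈ Finset.range h, if (i : ℝ) ≤ j then binomWeight n α i else 0
  induction h with
  | zero => simp
  | succ h ih =>
    rw [Finset.sum_range_succ, ← ih]
    by_cases hi : i ≤ h
    · have : (i : ℝ) ≤ h := by exact_mod_cast hi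
      rw [if_pos this, max_eq_left (by push_cast; linarith), max_eq_left (by linarith)]
      push_cast
      ring
    · have : (h : ℝ) + 1 ≤ i := by exact_mod_cast Nat.lt_of_not_le hi
      rw [if_neg (by linarith), max_eq_right (by push_cast; linarith),
        max_eq_right (by linarith), add_zero]

section Probability

variable {Ω ι : Type*} [MeasurableSpace Ω] {μ : Measure Ω}

lemma integrable_antitone_comp_sum [IsFiniteMeasure μ] {L : ι → Ω → ℝ}
    (hmeas : ∀ i, Measurable (L i)) (hval : ∀ i ω, L i ω ∈ Set.Icc (0 : ℝ) 1)
    {f : ℝ → ℝ} (hf : Antitone f) (s : Finset ι) :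
    Integrable (fun ω => f (∑ i ∈ s, L i ω)) μ := by
  refine Integrable.of_mem_Icc (f s.card) (f 0)
    (hf.measurable.comp (Finset.measurable_fun_sum s fun i _ => hmeas i)).aemeasurable
    (Filter.Eventually.of_forall fun ω => ⟨hf ?_, hf ?_⟩)
  · simpa using Finset.sum_le_sum fun i (_ : i ∈ s) => (hval i ω).2
  · exact Finset.sum_nonneg fun i _ => (hval i ω).1

/-- Among independent `[0,1]`-valued variables with means at least `α`, Bernoulli variables of
parameter `α` maximise expectations of antitone convex functions of the sum. -/
lemma integral_antitone_convex_comp_sum_le [IsProbabilityMeasure μ] {L : ι → Ω → ℝ}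
    (hmeas : ∀ i, Measurable (L i)) (hval : ∀ i ω, L i ω ∈ Set.Icc (0 : ℝ) 1)
    (hindep : iIndepFun L μ) {α : ℝ} (hα : α ∈ Set.Icc (0 : ℝ) 1) (hmean : ∀ i, α ≤ μ[L i])
    {f : ℝ → ℝ} (hf : Antitone f) (hconv : ConvexOn ℝ Set.univ f) (s : Finset ι) :
    ∫ ω, f (∑ i ∈ s, L i ω) ∂μ ≤
      ∑ i ∈ Finset.range (s.card + 1), binomWeight s.card α i * f i := by
  classical
  induction s using Finset.induction_on generalizing f with
  | empty => simp [binomWeight]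
  | insert a s ha ih =>
    have hf' : Antitone fun x => f (x + 1) := fun x y hxy => hf (by linarith)
    have hconv' : ConvexOn ℝ Set.univ fun x => f (x + 1) := by
      simpa [Function.comp_def] using hconv.translate_left 1
    set S : Ω → ℝ := fun ω => ∑ i ∈ s, L i ω with hS
    have hSmeas : Measurable S := Finset.measurable_fun_sum s fun i _ => hmeas i
    have hind : IndepFun S (L a) μ := by
      have h := hindep.indepFun_finsetSum_of_notMem hmeas ha
      convert h using 1
      ext ω
      simp [hS]
    have hLint : Integrable (L a) μ :=
      Integrable.of_mem_Icc 0 1 (hmeas a).aemeasurable (Filter.Eventually.of_forall (hval a))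
    have hint := integrable_antitone_comp_sum (μ := μ) hmeas hval hf s
    have hint' := integrable_antitone_comp_sum (μ := μ) hmeas hval hf' s
    have hintD : Integrable (fun ω => f (S ω) - f (S ω + 1)) μ := hint.sub hint'
    have hindD : IndepFun (fun ω => f (S ω) - f (S ω + 1)) (L a) μ :=
      hind.comp (hf.measurable.sub hf'.measurable) measurable_id
    have hprodint : Integrable (fun ω => (f (S ω) - f (S ω + 1)) * L a ω) μ :=
      hindD.integrable_mul hintD hLint
    have hprod : ∫ ω, (f (S ω) - f (S ω + 1)) * L a ω ∂μ =
        (∫ ω, f (S ω) ∂μ - ∫ ω, f (S ω + 1) ∂μ) * μ[L a] := by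
      rw [hindD.integral_fun_mul_eq_mul_integral hintD.aestronglyMeasurable
        hLint.aestronglyMeasurable, integral_sub hint hint']
    have hmono : ∫ ω, f (S ω + 1) ∂μ ≤ ∫ ω, f (S ω) ∂μ :=
      integral_mono hint' hint fun ω => hf (by linarith)
    have hstep : ∫ ω, f (∑ i ∈ insert a s, L i ω) ∂μ ≤
        ∫ ω, (f (S ω) - (f (S ω) - f (S ω + 1)) * L a ω) ∂μ := by
      refine integral_mono (integrable_antitone_comp_sum hmeas hval hf _)
        (hint.sub hprodint) fun ω => ?_
      have h := hconv.2 (Set.mem_univ (S ω)) (Set.mem_univ (S ω + 1))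
        (sub_nonneg.2 (hval a ω).2) (hval a ω).1 (by ring)
      simp only [smul_eq_mul] at h
      rw [show (1 - L a ω) * S ω + L a ω * (S ω + 1) = L a ω + S ω by ring] at h
      rw [Finset.sum_insert ha]
      linarith
    rw [integral_sub hint hprodint, hprod] at hstep
    have h1 := ih hf hconv
    have h2 := ih hf' hconv'
    rw [Finset.card_insert_of_notMem ha, sum_binomWeight_succ_mul s.card α fun i => f i]
    push_cast
    have h3 := mul_le_mul_of_nonneg_left h1 (sub_nonneg.2 hα.2)
    have h4 := mul_le_mul_of_nonneg_left h2 hα.1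
    have h5 := mul_le_mul_of_nonneg_left (hmean a) (sub_nonneg.2 hmono)
    linarith

/-- Lower tail bound from a nonnegative antitone convex test function. -/
lemma mul_measureReal_sum_le_le {n : ℕ} [IsProbabilityMeasure μ] {L : Fin n → Ω → ℝ}
    (hmeas : ∀ i, Measurable (L i)) (hval : ∀ i ω, L i ω ∈ Set.Icc (0 : ℝ) 1)
    (hindep : iIndepFun L μ) {α : ℝ} (hα : α ∈ Set.Icc (0 : ℝ) 1) (hmean : ∀ i, α ≤ μ[L i])
    {f : ℝ → ℝ} (hf : Antitone f) (hconv : ConvexOn ℝ Set.univ f) (hf0 : ∀ x, 0 ≤ f x) (t : ℝ) :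
    f t * μ.real {ω | ∑ i, L i ω ≤ t} ≤
      ∑ i ∈ Finset.range (n + 1), binomWeight n α i * f i := by
  have h1 := integral_antitone_convex_comp_sum_le hmeas hval hindep hα hmean hf hconv Finset.univ
  have h2 := mul_meas_ge_le_integral_of_nonneg (μ := μ)
    (Filter.Eventually.of_forall fun ω => hf0 (∑ i, L i ω))
    (integrable_antitone_comp_sum hmeas hval hf Finset.univ) (f t)
  rw [Finset.card_univ, Fintype.card_fin] at h1
  refine le_trans ?_ (h2.trans h1)
  exact mul_le_mul_of_nonneg_left (measureReal_mono fun ω hω => hf hω) (hf0 t)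

lemma antitone_max_sub (c : ℝ) : Antitone fun x : ℝ => max (c - x) 0 :=
  fun x y hxy => max_le_max (by linarith) le_rfl

lemma convexOn_max_sub (c : ℝ) : ConvexOn ℝ Set.univ fun x : ℝ => max (c - x) 0 :=
  ((convexOn_const c convex_univ).sub (concaveOn_id convex_univ)).sup
    (convexOn_const 0 convex_univ)

/-- Bentkus' inequality for the lower tail. -/
lemma measureReal_sum_le_le_exp_mul_binomCdf {n : ℕ} [IsProbabilityMeasure μ]
    {L : Fin n → Ω → ℝ} (hmeas : ∀ i, Measurable (L i))
    (hval : ∀ i ω, L i ω ∈ Set.Icc (0 : ℝ) 1) (hindep : iIndepFun L μ) {α : ℝ}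
    (hα : α ∈ Set.Ioo (0 : ℝ) 1) (hmean : ∀ i, α ≤ μ[L i]) (k : ℕ) :
    μ.real {ω | ∑ i, L i ω ≤ k} ≤ Real.exp 1 * binomCdf n α k := by
  rcases le_or_gt n k with hk | hk
  · rw [binomCdf_eq_one hk, mul_one]
    exact measureReal_le_one.trans (Real.one_le_exp zero_le_one)
  obtain ⟨m, hm, hle⟩ := exists_sum_binomCdf_le hα hk
  have h := mul_measureReal_sum_le_le hmeas hval hindep (Set.Ioo_subset_Icc_self hα) hmean
    (antitone_max_sub ((k + m : ℕ) : ℝ)) (convexOn_max_sub _) (fun x => le_max_right _ _) k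
  have hm' : (0 : ℝ) < m := by exact_mod_cast hm
  rw [sum_binomWeight_mul_max,
    show max (((k + m : ℕ) : ℝ) - k) 0 = m by push_cast; rw [add_sub_cancel_left]; simp] at h
  refine le_of_mul_le_mul_left ?_ hm'
  linarith

lemma exp_neg_h1 {α r : ℝ} (hα : α ∈ Set.Ioo (0 : ℝ) 1) (hr : r ∈ Set.Ioo (0 : ℝ) 1) :
    Real.exp (-h1 r α) =
      (1 - α) / (1 - r) * Real.exp (-(r * Real.log (r * (1 - α) / (α * (1 - r))))) := by
  have hα0 := hα.1
  have hα1 : 0 < 1 - α := sub_pos.2 hα.2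
  have hr0 := hr.1
  have hr1 : 0 < 1 - r := sub_pos.2 hr.2
  rw [← Real.exp_log (div_pos hα1 hr1), ← Real.exp_add, h1]
  congr 1
  rw [Real.log_div hα1.ne' hr1.ne', Real.log_div hr0.ne' hα0.ne', Real.log_div hr1.ne' hα1.ne',
    Real.log_div (mul_pos hr0 hα1).ne' (mul_pos hα0 hr1).ne', Real.log_mul hr0.ne' hα1.ne',
    Real.log_mul hα0.ne' hr1.ne']
  ring

/-- Hoeffding's inequality for the lower tail, in relative entropy form. -/
lemma measureReal_sum_le_le_exp_h1 {n : ℕ} [IsProbabilityMeasure μ]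
    {L : Fin n → Ω → ℝ} (hmeas : ∀ i, Measurable (L i))
    (hval : ∀ i ω, L i ω ∈ Set.Icc (0 : ℝ) 1) (hindep : iIndepFun L μ) {α : ℝ}
    (hα : α ∈ Set.Ioo (0 : ℝ) 1) (hmean : ∀ i, α ≤ μ[L i]) {r : ℝ} (hr : 0 ≤ r) :
    μ.real {ω | ∑ i, L i ω ≤ n * r} ≤ Real.exp (-(n : ℝ) * h1 (min r α) α) := by
  have hα0 := hα.1
  have hα1 : 0 < 1 - α := sub_pos.2 hα.2
  have hα' := Set.Ioo_subset_Icc_self hα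
  rcases le_or_gt α r with hrα | hrα
  · have : h1 α α = 0 := by simp [h1, div_self hα0.ne', div_self hα1.ne']
    rw [min_eq_right hrα, this, mul_zero, Real.exp_zero]
    exact measureReal_le_one
  rw [min_eq_left hrα.le, neg_mul, ← mul_neg, Real.exp_nat_mul]
  rcases hr.eq_or_lt with rfl | hr0
  · have h := mul_measureReal_sum_le_le hmeas hval hindep hα' hmean
      (antitone_max_sub ((1 : ℕ) : ℝ)) (convexOn_max_sub _) (fun x => le_max_right _ _) 0
    rw [sum_binomWeight_mul_max, Finset.sum_range_one, binomCdf_natCast] at h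
    have hexp : Real.exp (-h1 0 α) = 1 - α := by
      simp [h1, Real.exp_log hα1]
    rw [hexp]
    simpa [binomWeight] using h
  have hr1 : 0 < 1 - r := by linarith
  set s : ℝ := r * (1 - α) / (α * (1 - r)) with hs
  have hs0 : 0 < s := by positivity
  have hs1 : s ≤ 1 := by
    rw [hs, div_le_one (by positivity)]
    linarith
  have hanti : Antitone fun x : ℝ => Real.exp (Real.log s * x) := fun x y hxy =>
    Real.exp_le_exp.2 (mul_le_mul_of_nonpos_left hxy (Real.log_nonpos hs0.le hs1))
  have hconv : ConvexOn ℝ Set.univ fun x : ℝ => Real.exp (Real.log s * x) := by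
    simpa [Function.comp_def] using convexOn_exp.comp_linearMap (LinearMap.mulLeft ℝ (Real.log s))
  have h := mul_measureReal_sum_le_le hmeas hval hindep hα' hmean hanti hconv
    (fun x => (Real.exp_pos _).le) (n * r)
  have hgen : ∑ i ∈ Finset.range (n + 1), binomWeight n α i * Real.exp (Real.log s * i) =
      ((1 - α) / (1 - r)) ^ n := by
    rw [show (1 - α) / (1 - r) = α * s + (1 - α) by rw [hs]; field_simp; ring, add_pow]
    refine Finset.sum_congr rfl fun i _ => ?_
    rw [mul_comm (Real.log s), Real.exp_nat_mul, Real.exp_log hs0, binomWeight, mul_pow]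
    ring
  rw [hgen] at h
  rw [exp_neg_h1 hα ⟨hr0, by linarith⟩, mul_pow, ← hs, ← Real.exp_nat_mul]
  refine le_of_mul_le_mul_left (h.trans_eq ?_) (Real.exp_pos (Real.log s * (n * r)))
  rw [mul_left_comm, ← Real.exp_add,
    show Real.log s * (n * r) + n * -(r * Real.log s) = 0 by ring, Real.exp_zero, mul_one]

/-- The probability integral transform is super-uniform. -/
lemma measure_cdf_comp_le (X : Ω → ℝ) (u : ENNReal) :
    μ {ω | μ {ω' | X ω' ≤ X ω} ≤ u} ≤ u := by
  set A : Set ℝ := {x | μ {ω' | X ω' ≤ x} ≤ u}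
  have hlower : ∀ x y, x ≤ y → y ∈ A → x ∈ A := fun x y hxy hy =>
    (measure_mono fun ω (hω : X ω ≤ x) => hω.trans hxy).trans hy
  change μ {ω | X ω ∈ A} ≤ u
  by_cases hmax : ∃ x ∈ A, ∀ y ∈ A, y ≤ x
  · obtain ⟨x, hx, hxmax⟩ := hmax
    exact (measure_mono fun ω (hω : X ω ∈ A) => hxmax (X ω) hω).trans hx
  push Not at hmax
  have hcover : {ω | X ω ∈ A} ⊆ ⋃ q : {q : ℚ // (q : ℝ) ∈ A}, {ω | X ω ≤ (q : ℚ)} := by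
    intro ω hω
    obtain ⟨y, hy, hlt⟩ := hmax _ hω
    obtain ⟨q, hq1, hq2⟩ := exists_rat_btwn hlt
    exact Set.mem_iUnion.2 ⟨⟨q, hlower _ _ hq2.le hy⟩, hq1.le⟩
  refine (measure_mono hcover).trans ?_
  rw [Directed.measure_iUnion]
  · exact iSup_le fun q => q.2
  · refine Monotone.directed_le fun p q hpq ω (hω : X ω ≤ (p : ℚ)) => hω.trans ?_
    exact_mod_cast hpq

end Probability

/-- For i.i.d. losses `L 1, …, L n` taking values in `[0,1]` with mean `R = E[L 1] > α`,
the Hoeffding-Bentkus p-value computed from the empirical risk `R̂ = (1/n) ∑ L i`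
is super-uniform: `P(p^{H-B} ≤ u) ≤ u` for all `u ∈ (0,1)`. -/
theorem pHB_superuniform
    {Ω : Type*} [MeasurableSpace Ω] (μ : Measure Ω) [IsProbabilityMeasure μ]
    (n : ℕ) (hn : 0 < n) (L : Fin n → Ω → ℝ)
    (hmeas : ∀ i, Measurable (L i))
    (hval : ∀ i ω, L i ω ∈ Set.Icc (0 : ℝ) 1)
    (hindep : iIndepFun L μ)
    (hident : ∀ i, IdentDistrib (L i) (L ⟨0, hn⟩) μ μ)
    (α : ℝ) (hα : α ∈ Set.Ioo (0 : ℝ) 1)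
    (hnull : μ[L ⟨0, hn⟩] > α)
    (u : ℝ) (hu : u ∈ Set.Ioo (0 : ℝ) 1) :
    μ {ω | pHB n α ((1 / (n : ℝ)) * ∑ i, L i ω) ≤ u} ≤ ENNReal.ofReal u := by
  have hn' : (0 : ℝ) < n := by exact_mod_cast hn
  have hmean : ∀ i, α ≤ μ[L i] := fun i => by
    rw [(hident i).integral_eq]
    exact hnull.le
  refine (measure_mono fun ω hω => ?_).trans
    (measure_cdf_comp_le (μ := μ) (fun ω => ∑ i, L i ω) (ENNReal.ofReal u))
  have hS : 0 ≤ ∑ i, L i ω := Finset.sum_nonneg fun i _ => (hval i ω).1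
  have hcancel : (n : ℝ) * (1 / (n : ℝ) * ∑ i, L i ω) = ∑ i, L i ω := by field_simp
  have hHoeffding := measureReal_sum_le_le_exp_h1 hmeas hval hindep hα hmean
    (r := 1 / (n : ℝ) * ∑ i, L i ω) (by positivity)
  have hBentkus := measureReal_sum_le_le_exp_mul_binomCdf hmeas hval hindep hα hmean
    ⌈(n : ℝ) * (1 / (n : ℝ) * ∑ i, L i ω)⌉₊
  have hceil := Nat.le_ceil ((n : ℝ) * (1 / (n : ℝ) * ∑ i, L i ω))
  have hle : μ.real {ω' | ∑ i, L i ω' ≤ ∑ i, L i ω} ≤ u := by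
    refine le_trans (le_min (le_trans (measureReal_mono fun ω' hω' => ?_) hBentkus) ?_) hω
    · exact (hω'.trans_eq hcancel.symm).trans hceil
    · rwa [hcancel] at hHoeffding
  exact (ENNReal.le_ofReal_iff_toReal_le (measure_ne_top _ _) hu.1.le).2 hle
end

section
/- Let L_1(lambda), ..., L_n(lambda) be i.i.d. random losses in {0,1} indexed by lambda in a finite grid Lambda_tilde = {lambda_0 < lambda_1 < ... < lambda_{Q-1}}, with risk R(lambda) = E[L_1(lambda)], let alpha, delta in (0,1), and for each j define the empirical risk R_hat_j = (1/n) * sum_{i=1}^n L_i(lambda_j) and the p-value p_j = P(Bin(n, alpha) <= n * R_hat_j). Run the fixed sequence procedure: let Gamma = {lambda_j : p_i <= delta for all i <= j}. Then P( sup_{lambda in Gamma} R(lambda) <= alpha ) >= 1 - delta, where the supremum over the empty set is -infinity; in particular, on the event that Gamma is nonempty, the largest selected hyper-parameter lambda_hat = max(Gamma) satisfies R(lambda_hat) <= alpha with probability at least 1 - delta. -/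
open MeasureTheory ProbabilityTheory

/-- Conditioning on the last trial: the Pascal recursion for the binomial CDF. -/
lemma binomCdf_succ (n : ℕ) (α x : ℝ) :
    binomCdf (n + 1) α x = α * binomCdf n α (x - 1) + (1 - α) * binomCdf n α x := by
  set f : ℕ → ℝ := fun i => if (i : ℝ) ≤ x then 1 else 0 with hf
  have hx (m : ℕ) : binomCdf m α x =
      ∑ i ∈ Finset.range (m + 1), f i * ((m.choose i : ℝ) * α ^ i * (1 - α) ^ (m - i)) := by
    simp [binomCdf, hf]
  have hshift : binomCdf n α (x - 1) = ∑ i ∈ Finset.range (n + 1),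
      f (i + 1) * ((n.choose i : ℝ) * α ^ i * (1 - α) ^ (n - i)) := by
    simp [binomCdf, hf, le_sub_iff_add_le]
  have hstay : (1 - α) * binomCdf n α x = ∑ i ∈ Finset.range (n + 2),
      f i * ((n.choose i : ℝ) * α ^ i * (1 - α) ^ (n + 1 - i)) := by
    rw [hx, Finset.sum_range_succ _ (n + 1), Nat.choose_succ_self, Finset.mul_sum]
    simp only [Nat.cast_zero, zero_mul, mul_zero, add_zero]
    refine Finset.sum_congr rfl fun i hi => ?_
    rw [Nat.sub_add_comm (Finset.mem_range_succ_iff.mp hi), pow_succ]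
    ring
  rw [hstay, hx, hshift, Finset.sum_range_succ' _ (n + 1), Finset.sum_range_succ' _ (n + 1),
    ← add_assoc, Finset.mul_sum, ← Finset.sum_add_distrib]
  congr 1
  · refine Finset.sum_congr rfl fun i _ => ?_
    rw [Nat.choose_succ_succ, Nat.add_sub_add_right]
    push_cast
    ring
  · simp

/-- A sum of independent Bernoulli variables with success probabilities at least `α`
stochastically dominates `Bin(n, α)`. -/
lemma measureReal_sum_le_binomCdf {Ω ι : Type*} [MeasurableSpace Ω] {μ : Measure Ω}
    [IsProbabilityMeasure μ] {X : ι → Ω → ℝ} (hX : ∀ k, Measurable (X k))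
    (hbin : ∀ k ω, X k ω = 0 ∨ X k ω = 1) (hindep : iIndepFun X μ) {α : ℝ} (hα₀ : 0 ≤ α)
    (hα₁ : α ≤ 1) (hα : ∀ k, α ≤ μ.real {ω | X k ω = 1}) (s : Finset ι) (x : ℝ) :
    μ.real {ω | ∑ k ∈ s, X k ω ≤ x} ≤ binomCdf s.card α x := by
  classical
  induction s using Finset.induction_on generalizing x with
  | empty =>
    by_cases h : 0 ≤ x <;> simp [binomCdf, h]
  | insert a s ha ih =>
    have hmul (c y : ℝ) : μ.real ({ω | X a ω = c} ∩ {ω | ∑ k ∈ s, X k ω ≤ y}) =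
        μ.real {ω | X a ω = c} * μ.real {ω | ∑ k ∈ s, X k ω ≤ y} := by
      have h := (hindep.indepFun_finsetSum_of_notMem hX ha).symm.measure_inter_preimage_eq_mul
        {c} (Set.Iic y) (measurableSet_singleton c) measurableSet_Iic
      have h' := congrArg ENNReal.toReal h
      rw [ENNReal.toReal_mul] at h'
      simpa [Measure.real, Set.preimage, Finset.sum_apply] using h'
    have hsplit : {ω | ∑ k ∈ insert a s, X k ω ≤ x} =
        ({ω | X a ω = 1} ∩ {ω | ∑ k ∈ s, X k ω ≤ x - 1}) ∪
          ({ω | X a ω = 0} ∩ {ω | ∑ k ∈ s, X k ω ≤ x}) := by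
      ext ω
      simp only [Finset.sum_insert ha, Set.mem_ofPred_eq, Set.mem_union, Set.mem_inter_iff]
      rcases hbin a ω with h | h <;> simp [h, le_sub_iff_add_le, add_comm]
    have hdisj : Disjoint ({ω | X a ω = 1} ∩ {ω | ∑ k ∈ s, X k ω ≤ x - 1})
        ({ω | X a ω = 0} ∩ {ω | ∑ k ∈ s, X k ω ≤ x}) := by
      refine Set.disjoint_left.mpr fun ω h₁ h₀ => one_ne_zero (α := ℝ) ?_
      exact h₁.1.symm.trans h₀.1
    have hzero : μ.real {ω | X a ω = 0} = 1 - μ.real {ω | X a ω = 1} := by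
      have hone : MeasurableSet {ω | X a ω = 1} := hX a (measurableSet_singleton 1)
      rw [← probReal_compl_eq_one_sub hone]
      congr 1
      ext ω
      rcases hbin a ω with h | h <;> simp [h]
    have hmeas : MeasurableSet ({ω | X a ω = 0} ∩ {ω | ∑ k ∈ s, X k ω ≤ x}) :=
      (hX a (measurableSet_singleton 0)).inter
        (measurableSet_le (Finset.measurable_fun_sum _ fun k _ => hX k) measurable_const)
    have hmono : μ.real {ω | ∑ k ∈ s, X k ω ≤ x - 1} ≤ μ.real {ω | ∑ k ∈ s, X k ω ≤ x} :=
      measureReal_mono fun ω (h : _ ≤ _) => h.trans (sub_le_self x zero_le_one)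
    rw [hsplit, measureReal_union hdisj hmeas, hmul, hmul, hzero, Finset.card_insert_of_notMem ha,
      binomCdf_succ]
    have h₁ := mul_le_mul_of_nonneg_left (ih (x - 1)) hα₀
    have h₀ := mul_le_mul_of_nonneg_left (ih x) (sub_nonneg.mpr hα₁)
    have hswap := mul_nonneg (sub_nonneg.mpr (hα a)) (sub_nonneg.mpr hmono)
    linarith

lemma exists_nat_le_card_sum_eq {ι : Type*} (s : Finset ι) (x : ι → ℝ)
    (hx : ∀ k, x k = 0 ∨ x k = 1) : ∃ m ≤ s.card, ∑ k ∈ s, x k = (m : ℝ) := by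
  refine ⟨(s.filter fun k => x k = 1).card, Finset.card_filter_le _ _, ?_⟩
  rw [← Finset.sum_boole]
  refine Finset.sum_congr rfl fun k _ => ?_
  rcases hx k with h | h <;> simp [h]

/-- Super-uniformity of the binomial p-value under the null. -/
lemma measureReal_binomCdf_sum_le {Ω ι : Type*} [MeasurableSpace Ω] {μ : Measure Ω}
    [IsProbabilityMeasure μ] {X : ι → Ω → ℝ} (hX : ∀ k, Measurable (X k))
    (hbin : ∀ k ω, X k ω = 0 ∨ X k ω = 1) (hindep : iIndepFun X μ) {α : ℝ} (hα₀ : 0 ≤ α)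
    (hα₁ : α ≤ 1) (hα : ∀ k, α ≤ μ.real {ω | X k ω = 1}) (s : Finset ι) {δ : ℝ} (hδ : 0 ≤ δ) :
    μ.real {ω | binomCdf s.card α (∑ k ∈ s, X k ω) ≤ δ} ≤ δ := by
  set A := (Finset.range (s.card + 1)).filter fun m : ℕ => binomCdf s.card α m ≤ δ with hA
  have hmem (ω : Ω) (hω : binomCdf s.card α (∑ k ∈ s, X k ω) ≤ δ) :
      ∃ m ∈ A, ∑ k ∈ s, X k ω = (m : ℝ) := by
    obtain ⟨m, hm, hsum⟩ := exists_nat_le_card_sum_eq s (fun k => X k ω) fun k => hbin k ω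
    exact ⟨m, Finset.mem_filter.mpr ⟨Finset.mem_range_succ_iff.mpr hm, hsum ▸ hω⟩, hsum⟩
  rcases A.eq_empty_or_nonempty with hempty | hne
  · have : {ω | binomCdf s.card α (∑ k ∈ s, X k ω) ≤ δ} = ∅ := by
      refine Set.eq_empty_of_forall_notMem fun ω hω => ?_
      obtain ⟨m, hm, -⟩ := hmem ω hω
      simp [hempty] at hm
    simpa [this] using hδ
  · calc μ.real {ω | binomCdf s.card α (∑ k ∈ s, X k ω) ≤ δ}
        ≤ μ.real {ω | ∑ k ∈ s, X k ω ≤ (A.max' hne : ℝ)} := by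
          refine measureReal_mono fun ω hω => ?_
          obtain ⟨m, hm, hsum⟩ := hmem ω hω
          simpa [hsum] using A.le_max' m hm
      _ ≤ binomCdf s.card α (A.max' hne) :=
          measureReal_sum_le_binomCdf hX hbin hindep hα₀ hα₁ hα s _
      _ ≤ δ := (Finset.mem_filter.mp (A.max'_mem hne)).2

lemma integral_eq_measureReal_eq_one {Ω : Type*} [MeasurableSpace Ω] {μ : Measure Ω}
    {X : Ω → ℝ} (hX : Measurable X) (hbin : ∀ ω, X ω = 0 ∨ X ω = 1) :
    ∫ ω, X ω ∂μ = μ.real {ω | X ω = 1} := by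
  have hone : MeasurableSet {ω | X ω = 1} := hX (measurableSet_singleton 1)
  rw [← integral_indicator_one hone]
  refine integral_congr_ae (.of_forall fun ω => ?_)
  rcases hbin ω with h | h <;> simp [h]

/-- Risk control for the calibrated pruning ratio. Let `L i ω j` be binary losses indexed
by hyper-parameters `λ 0 < λ 1 < … < λ (Q-1)` and evaluated on an i.i.d. calibration sample
of size `n`, with risk `R j = E[L 1 (λ j)]`. For each `j` form the empirical risk
`R̂ j = (1/n) ∑ᵢ L i (λ j)` and the p-value `p j = P(Bin(n, α) ≤ n·R̂ j)`, and let the fixed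
sequence procedure select `Γ = {λ j : p i ≤ δ for all i ≤ j}`. Then with probability at
least `1 - δ`, every selected hyper-parameter `λ j ∈ Γ` satisfies `R j ≤ α` (i.e.
`sup_{λ ∈ Γ} R(λ) ≤ α`, the supremum over the empty set being `-∞`); in particular on the
event `Γ ≠ ∅` the largest selected hyper-parameter `λ̂ = max Γ` satisfies `R(λ̂) ≤ α`. -/
theorem fixedSequence_binomial_risk_control
    {Ω : Type*} [MeasurableSpace Ω] (μ : Measure Ω) [IsProbabilityMeasure μ]
    (n : ℕ) (hn : 0 < n) (Q : ℕ)
    (lam : Fin Q → ℝ) (hlam : StrictMono lam)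
    (L : Fin n → Ω → (Fin Q → ℝ))
    (hmeas : ∀ i, Measurable (L i))
    (hbin : ∀ i ω j, L i ω j = 0 ∨ L i ω j = 1)
    (hindep : iIndepFun L μ)
    (hident : ∀ i, IdentDistrib (L i) (L ⟨0, hn⟩) μ μ)
    (α : ℝ) (hα : α ∈ Set.Ioo (0 : ℝ) 1)
    (δ : ℝ) (hδ : δ ∈ Set.Ioo (0 : ℝ) 1)
    (R : Fin Q → ℝ) (hrisk : ∀ j, R j = μ[fun ω => L ⟨0, hn⟩ ω j]) :
    μ {ω | ∀ j : Fin Q,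
        (∀ i ≤ j, binomCdf n α ((n : ℝ) * ((1 / (n : ℝ)) * ∑ k, L k ω i)) ≤ δ) →
        R j ≤ α}
      ≥ 1 - ENNReal.ofReal δ := by
  by_cases hall : ∀ j, R j ≤ α
  · simp [hall]
  push Not at hall
  obtain ⟨j₀, hj₀, hmin⟩ := WellFounded.has_min (wellFounded_lt (α := Fin Q)) {j | α < R j} hall
  have hX (k : Fin n) : Measurable fun ω => L k ω j₀ := (measurable_pi_apply j₀).comp (hmeas k)
  have hprob (k : Fin n) : α ≤ μ.real {ω | L k ω j₀ = 1} := by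
    rw [← integral_eq_measureReal_eq_one (hX k) fun ω => hbin k ω j₀]
    have hint : ∫ ω, L k ω j₀ ∂μ = ∫ ω, L ⟨0, hn⟩ ω j₀ ∂μ :=
      ((hident k).comp (measurable_pi_apply j₀)).integral_eq
    rw [hint, ← hrisk j₀]
    exact le_of_lt hj₀
  have hnull := measureReal_binomCdf_sum_le hX (fun k ω => hbin k ω j₀)
    (hindep.comp (fun _ v => v j₀) fun _ => measurable_pi_apply j₀) hα.1.le hα.2.le hprob
    Finset.univ hδ.1.le
  rw [Finset.card_fin] at hnull
  have hn' : (n : ℝ) ≠ 0 := Nat.cast_ne_zero.mpr hn.ne'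
  set B := {ω | binomCdf n α (∑ k, L k ω j₀) ≤ δ}
  have hB : μ B ≤ ENNReal.ofReal δ := by
    rw [← ofReal_measureReal]
    exact ENNReal.ofReal_le_ofReal hnull
  set G := {ω | ∀ j : Fin Q,
    (∀ i ≤ j, binomCdf n α ((n : ℝ) * ((1 / (n : ℝ)) * ∑ k, L k ω i)) ≤ δ) → R j ≤ α}
  have hcover : Set.univ ⊆ G ∪ B := by
    intro ω _
    by_cases hω : ω ∈ B
    · exact .inr hω
    refine .inl fun j hj => le_of_not_gt fun hRj => hω ?_
    have h := hj j₀ (not_lt.mp (hmin j hRj))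
    rwa [← mul_assoc, mul_one_div_cancel hn', one_mul] at h
  rw [ge_iff_le, tsub_le_iff_right]
  calc (1 : ENNReal) = μ Set.univ := measure_univ.symm
    _ ≤ μ G + μ B := (measure_mono hcover).trans (measure_union_le G B)
    _ ≤ μ G + ENNReal.ofReal δ := by gcongr
end
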